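/- Let 𝒫 be an admissible family of positive cones and let Φ ∈ 𝒞_𝒫(A,B) ∩ CP and Ψ ∈ 𝒞_𝒫(A,B') ∩ CP be trace preserving maps that are both 𝒫-positive and completely positive. If Ψ is 0-post-processing deficient with respect to Φ for the family CP (i.e. Ψ ⪰_{0,D,CP} Φ for every finite-dimensional C*-algebra D), then Ψ is 0-post-processing deficient with respect to Φ for the family 𝒫 (i.e. Ψ ⪰_{0,D,𝒫} Φ for every D). If moreover CP(H,K) ⊆ 𝒫(H,K) for all H,K, then for every ε ≥ 0, Ψ ⪰_{ε,D,CP} Φ for every D implies Ψ ⪰_{ε,D,𝒫} Φ for every D. -/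

import Mathlib

noncomputable section

open Matrix Complex Filter
open scoped Kronecker ComplexOrder

/-- The algebra `B(H)` of operators on the Hilbert space with orthonormal basis indexed by `ι`,
modelled as matrices. -/
abbrev Mat (ι : Type) : Type := Matrix ι ι ℂ

/-- The space of all maps `B(H) → B(K)`. -/
abbrev HMap (ι κ : Type) : Type := Mat ι → Mat κ

section Defs
variable {ι κ μ ν γ γ' : Type}

/-- A Hermitian (i.e. complex-linear and Hermiticity preserving) map `B(H) → B(K)`. -/
def IsHermMap [Fintype ι] [Fintype κ] (φ : HMap ι κ) : Prop :=
  IsLinearMap ℂ φ ∧ ∀ a : Mat ι, φ aᴴ = (φ a)ᴴ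

/-- The real vector space `L(H,K)` of Hermitian maps, as a subset of all maps. -/
def LHK (ι κ : Type) [Fintype ι] [Fintype κ] : Set (HMap ι κ) := {φ | IsHermMap φ}

/-- The functional `s(φ) = ∑_{i,j} ⟨e_i, φ(|e_i⟩⟨e_j|) e_j⟩`. -/
def sC [Fintype ι] [DecidableEq ι] (φ : HMap ι ι) : ℂ :=
  ∑ i, ∑ j, φ (Matrix.single i j 1) i j

/-- The duality pairing `⟨φ,ψ⟩ = s(ψ ∘ φ)` between `L(H,K)` and `L(K,H)`. -/
def pairing [Fintype ι] [DecidableEq ι] [Fintype κ] (φ : HMap ι κ) (ψ : HMap κ ι) : ℝ :=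
  (sC (ψ ∘ φ)).re

/-- The map `φ ⊗ id_F`. -/
def tensorId (φ : HMap ι κ) (γ : Type) : Mat (ι × γ) → Mat (κ × γ) :=
  fun M => Matrix.of fun p q => φ (Matrix.of fun i i' => M (i, p.2) (i', q.2)) p.1 q.1

/-- The map `id ⊗ f` on `B(H ⊗ D)`. -/
def idTensor (ι : Type) (f : HMap γ γ') : Mat (ι × γ) → Mat (ι × γ') :=
  fun M => Matrix.of fun p q => f (Matrix.of fun c c' => M (p.1, c) (q.1, c')) p.2 q.2

/-- The tensor product `φ ⊗ ξ` of two maps. -/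
def tensorFun [Fintype ι] [DecidableEq ι] (φ : HMap ι κ) (ξ : HMap γ γ') :
    Mat (ι × γ) → Mat (κ × γ') :=
  fun M => Matrix.of fun p q =>
    ∑ i, ∑ i', φ (Matrix.single i i' 1) p.1 q.1 *
      ξ (Matrix.of fun c c' => M (i, c) (i', c')) p.2 q.2

/-- The Choi matrix `C(φ) = (φ ⊗ id)(X_H)` of a map `φ : B(H) → B(K)`. -/
def Choi [DecidableEq ι] (φ : HMap ι κ) : Mat (κ × ι) :=
  Matrix.of fun p q => φ (Matrix.single p.2 q.2 1) p.1 q.1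

/-- The adjoint of a map with respect to the Hilbert-Schmidt inner products. -/
def adjFun [Fintype ι] [Fintype κ] [DecidableEq ι] (φ : HMap ι κ) : HMap κ ι :=
  fun b => Matrix.of fun i j => (φ (Matrix.single j i 1) * b).trace

/-- Trace preserving maps. -/
def TP [Fintype ι] [Fintype κ] (φ : HMap ι κ) : Prop := ∀ a, (φ a).trace = a.trace

/-- The cone `Pos(H,K)` of positive Hermitian maps. -/
def PosSet (ι κ : Type) [Fintype ι] [Fintype κ] : Set (HMap ι κ) :=
  {φ | IsHermMap φ ∧ ∀ a, a.PosSemidef → (φ a).PosSemidef}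

/-- The cone `CP(H,K)` of completely positive Hermitian maps. -/
def CPSet (ι κ : Type) [Fintype ι] [Fintype κ] : Set (HMap ι κ) :=
  {φ | IsHermMap φ ∧ ∀ (n : ℕ) (M : Mat (ι × Fin n)),
      M.PosSemidef → (tensorId φ (Fin n) M).PosSemidef}

/-- The cone `EB(H,K)` of entanglement breaking maps `a ↦ ∑_i Tr(F_i a) ρ_i`. -/
def EBSet (ι κ : Type) [Fintype ι] [Fintype κ] : Set (HMap ι κ) :=
  {φ | ∃ (N : ℕ) (F : Fin N → Mat ι) (ρ : Fin N → Mat κ),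
      (∀ i, (F i).PosSemidef) ∧ (∀ i, (ρ i).PosSemidef) ∧
      φ = fun a => ∑ i, ((F i * a).trace) • ρ i}

/-- Interior of `Q` relative to the subset `L`. -/
def relInt {X : Type*} [TopologicalSpace X] (L Q : Set X) : Set X :=
  {x | x ∈ Q ∧ Q ∈ nhdsWithin x L}

/-- A proper cone in the (sub)space `L`: closed, convex, closed under nonnegative scalar
multiples, pointed, and with nonempty interior relative to `L`. -/
def IsProperConeIn {X : Type*} [TopologicalSpace X] [AddCommGroup X] [Module ℝ X]
    (L Q : Set X) : Prop :=
  Q ⊆ L ∧ IsClosed Q ∧ Convex ℝ Q ∧ (∀ c : ℝ, 0 ≤ c → ∀ x ∈ Q, c • x ∈ Q) ∧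
    (∀ x, x ∈ Q → -x ∈ Q → x = 0) ∧ (relInt L Q).Nonempty

end Defs

/-- An admissible family of positive cones: a proper cone `Pf(H,K) ⊆ L(H,K)` for every pair of
(finite-dimensional) Hilbert spaces, with `EB ⊆ Pf ⊆ Pos`, closed under composition and under
composition with completely positive maps. -/
structure AdmissibleFamily : Type 1 where
  P : ∀ (ι κ : Type) [Fintype ι] [DecidableEq ι] [Fintype κ] [DecidableEq κ], Set (HMap ι κ)
  proper : ∀ (ι κ : Type) [Fintype ι] [DecidableEq ι] [Fintype κ] [DecidableEq κ],
    IsProperConeIn (LHK ι κ) (P ι κ)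
  eb_le : ∀ (ι κ : Type) [Fintype ι] [DecidableEq ι] [Fintype κ] [DecidableEq κ],
    EBSet ι κ ⊆ P ι κ
  le_pos : ∀ (ι κ : Type) [Fintype ι] [DecidableEq ι] [Fintype κ] [DecidableEq κ],
    P ι κ ⊆ PosSet ι κ
  comp_mem : ∀ (ι κ μ : Type) [Fintype ι] [DecidableEq ι] [Fintype κ] [DecidableEq κ]
      [Fintype μ] [DecidableEq μ],
    ∀ φ ∈ P ι κ, ∀ ψ ∈ P κ μ, (ψ ∘ φ) ∈ P ι μ
  cp_comp_mem : ∀ (ι κ μ ν : Type) [Fintype ι] [DecidableEq ι] [Fintype κ] [DecidableEq κ]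
      [Fintype μ] [DecidableEq μ] [Fintype ν] [DecidableEq ν],
    ∀ β ∈ CPSet ι κ, ∀ φ ∈ P κ μ, ∀ α ∈ CPSet μ ν, (α ∘ φ ∘ β) ∈ P ι ν

structure FdSubalgebra (ι : Type) [Fintype ι] [DecidableEq ι] : Type where
  car : Set (Mat ι)
  add_mem : ∀ {x y}, x ∈ car → y ∈ car → x + y ∈ car
  smul_mem : ∀ (c : ℂ) {x}, x ∈ car → c • x ∈ car
  one_mem : (1 : Mat ι) ∈ car
  mul_mem : ∀ {x y}, x ∈ car → y ∈ car → x * y ∈ car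
  star_mem : ∀ {x}, x ∈ car → xᴴ ∈ car
  E : Mat ι → Mat ι
  E_linear : IsLinearMap ℂ E
  E_mem : ∀ x, E x ∈ car
  E_fix : ∀ x ∈ car, E x = x
  E_trace : ∀ x y, y ∈ car → (E x * y).trace = (x * y).trace

namespace FdSubalgebra

set_option linter.unusedSectionVars false
variable {ι γ : Type} [Fintype ι] [DecidableEq ι] [Fintype γ] [DecidableEq γ]

lemma zero_mem (A : FdSubalgebra ι) : (0 : Mat ι) ∈ A.car := by
  simpa using A.smul_mem 0 A.one_mem

lemma sum_mem (A : FdSubalgebra ι) {α : Type*} {s : Finset α} {f : α → Mat ι}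
    (h : ∀ a ∈ s, f a ∈ A.car) : (∑ a ∈ s, f a) ∈ A.car :=
  Finset.sum_induction f (· ∈ A.car) (fun _ _ hx hy => A.add_mem hx hy) A.zero_mem h

/-- The full matrix algebra `B(H)`. -/
def full (ι : Type) [Fintype ι] [DecidableEq ι] : FdSubalgebra ι where
  car := Set.univ
  add_mem := fun _ _ => Set.mem_univ _
  smul_mem := by intro _ x _; exact Set.mem_univ _
  one_mem := Set.mem_univ _
  mul_mem := fun _ _ => Set.mem_univ _
  star_mem := fun _ => Set.mem_univ _
  E := id
  E_linear := ⟨fun _ _ => rfl, fun _ _ => rfl⟩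
  E_mem := fun _ => trivial
  E_fix := fun _ _ => rfl
  E_trace := fun _ _ _ => rfl

/-- The diagonal subalgebra `𝔻_n ⊆ B(ℂ^n)`. -/
def diag (n : ℕ) : FdSubalgebra (Fin n) where
  car := {M | ∀ i j, i ≠ j → M i j = 0}
  add_mem := by
    intro x y hx hy i j hij
    simp [hx i j hij, hy i j hij]
  smul_mem := by
    intro c x hx i j hij
    simp [hx i j hij]
  one_mem := by
    intro i j hij
    exact Matrix.one_apply_ne hij
  mul_mem := by
    intro x y hx hy i j hij
    show ∑ k, x i k * y k j = 0
    refine Finset.sum_eq_zero fun k _ => ?_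
    rcases eq_or_ne k i with rfl | hk
    · simp [hy k j hij]
    · simp [hx i k (Ne.symm hk)]
  star_mem := by
    intro x hx i j hij
    simp [Matrix.conjTranspose_apply, hx j i (Ne.symm hij)]
  E := fun M => Matrix.diagonal fun i => M i i
  E_linear := by
    constructor
    · intro x y
      ext i j
      by_cases h : i = j <;> simp [Matrix.diagonal, h]
    · intro c x
      ext i j
      by_cases h : i = j <;> simp [Matrix.diagonal, h]
  E_mem := by
    intro x i j hij
    simp [Matrix.diagonal_apply_ne _ hij]
  E_fix := by
    intro x hx
    ext i j
    by_cases h : i = j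
    · subst h; simp
    · simp [Matrix.diagonal_apply_ne _ h, hx i j h]
  E_trace := by
    intro x y hy
    have key : ∀ z : Mat (Fin n), (z * y).trace = ∑ i, z i i * y i i := by
      intro z
      simp only [Matrix.trace, Matrix.diag, Matrix.mul_apply]
      refine Finset.sum_congr rfl fun i _ => ?_
      refine Finset.sum_eq_single i (fun k _ hk => ?_) (by simp)
      simp [hy k i hk]
    rw [key, key]
    refine Finset.sum_congr rfl fun i _ => ?_
    simp


/-- The `(c,d)` block of a matrix on `H ⊗ D`. -/
def blk (M : Mat (ι × γ)) (c d : γ) : Mat ι := Matrix.of fun i j => M (i, c) (j, d)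

lemma blk_add (M N : Mat (ι × γ)) (c d : γ) : blk (M + N) c d = blk M c d + blk N c d := by
  ext i j; simp [blk]

lemma blk_smul (a : ℂ) (M : Mat (ι × γ)) (c d : γ) : blk (a • M) c d = a • blk M c d := by
  ext i j; simp [blk]

lemma blk_mul (M N : Mat (ι × γ)) (c d : γ) :
    blk (M * N) c d = ∑ e, blk M c e * blk N e d := by
  ext i j
  simp only [blk, Matrix.of_apply, Matrix.mul_apply, Matrix.sum_apply, Fintype.sum_prod_type]
  exact Finset.sum_comm

lemma trace_blk (M : Mat (ι × γ)) : M.trace = ∑ c, (blk M c c).trace := by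
  simp only [Matrix.trace, Matrix.diag, blk, Matrix.of_apply, Fintype.sum_prod_type]
  exact Finset.sum_comm

/-- The tensor product algebra `A ⊗ B(D) ⊆ B(H ⊗ D)`. -/
def tensorFull (A : FdSubalgebra ι) (γ : Type) [Fintype γ] [DecidableEq γ] :
    FdSubalgebra (ι × γ) where
  car := {M | ∀ c d, blk M c d ∈ A.car}
  add_mem := by
    intro x y hx hy c d
    rw [blk_add]; exact A.add_mem (hx c d) (hy c d)
  smul_mem := by
    intro a x hx c d
    rw [blk_smul]; exact A.smul_mem a (hx c d)
  one_mem := by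
    intro c d
    rcases eq_or_ne c d with rfl | hcd
    · have : blk (1 : Mat (ι × γ)) c c = 1 := by
        ext i j
        by_cases h : i = j
        · subst h; simp [blk, Matrix.one_apply]
        · simp [blk, Matrix.one_apply, h]
      rw [this]; exact A.one_mem
    · have : blk (1 : Mat (ι × γ)) c d = 0 := by
        ext i j
        simp [blk, Matrix.one_apply, hcd]
      rw [this]; exact A.zero_mem
  mul_mem := by
    intro x y hx hy c d
    rw [blk_mul]
    exact A.sum_mem fun e _ => A.mul_mem (hx c e) (hy e d)
  star_mem := by
    intro x hx c d
    have : blk xᴴ c d = (blk x d c)ᴴ := by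
      ext i j; simp [blk, Matrix.conjTranspose_apply]
    rw [this]; exact A.star_mem (hx d c)
  E := fun M => Matrix.of fun p q => A.E (blk M p.2 q.2) p.1 q.1
  E_linear := by
    constructor
    · intro x y
      ext p q
      simp [blk_add, (A.E_linear.map_add _ _)]
    · intro a x
      ext p q
      simp [blk_smul, (A.E_linear.map_smul _ _)]
  E_mem := by
    intro x c d
    have : blk (Matrix.of fun p q => A.E (blk x p.2 q.2) p.1 q.1) c d = A.E (blk x c d) := by
      ext i j; simp [blk]
    rw [this]; exact A.E_mem _
  E_fix := by
    intro x hx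
    ext p q
    show A.E (blk x p.2 q.2) p.1 q.1 = x p q
    rw [A.E_fix _ (hx p.2 q.2)]
    rfl
  E_trace := by
    intro x y hy
    have key : ∀ z : Mat (ι × γ), (z * y).trace = ∑ c, ∑ d, (blk z c d * blk y d c).trace := by
      intro z
      rw [trace_blk (z * y)]
      refine Finset.sum_congr rfl fun c _ => ?_
      rw [blk_mul, Matrix.trace_sum]
    rw [key, key]
    refine Finset.sum_congr rfl fun c _ => ?_
    refine Finset.sum_congr rfl fun d _ => ?_
    have hblk : blk (Matrix.of fun p q => A.E (blk x p.2 q.2) p.1 q.1) c d = A.E (blk x c d) := by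
      ext i j; simp [blk]
    rw [hblk, A.E_trace _ _ (hy d c)]

end FdSubalgebra


/-- The positive semidefinite square root of a positive semidefinite matrix (the definition
formerly in Mathlib). -/
def Matrix.PosSemidef.sqrt {n 𝕜 : Type*} [Fintype n] [RCLike 𝕜] [DecidableEq n]
    {A : Matrix n n 𝕜} (hA : A.PosSemidef) : Matrix n n 𝕜 :=
  hA.1.eigenvectorUnitary.1 * Matrix.diagonal ((↑) ∘ Real.sqrt ∘ hA.1.eigenvalues) *
    (star hA.1.eigenvectorUnitary : Matrix n n 𝕜)

section Main
variable {ι κ μ ν γ γ' : Type}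
variable [Fintype ι] [DecidableEq ι] [Fintype κ] [DecidableEq κ]

/-- The subspace `L(A,B)` of maps identified with `E_B ∘ φ ∘ E_A`. -/
def LAB (A : FdSubalgebra ι) (B : FdSubalgebra κ) : Set (HMap ι κ) :=
  {φ | (∀ a, φ a ∈ B.car) ∧ ∀ a, φ (A.E a) = φ a}

/-- The density operators (states) of the algebra `A`. -/
def States (A : FdSubalgebra ι) : Set (Mat ι) :=
  {σ | σ ∈ A.car ∧ σ.PosSemidef ∧ σ.trace = 1}

/-- The map `Φ_{I,σ} : a ↦ (Tr a) σ`. -/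
def PhiI (ι : Type) [Fintype ι] (σ : Mat κ) : HMap ι κ := fun a => a.trace • σ

/-- The cone `Pf(A,B) = Pf(H,K) ∩ L(A,B)`. -/
def PL (Pf : AdmissibleFamily) (A : FdSubalgebra ι) (B : FdSubalgebra κ) : Set (HMap ι κ) :=
  Pf.P ι κ ∩ LAB A B

/-- The set `𝒞(A,B)` of `Pf`-channels, i.e. trace preserving maps in `Pf(A,B)`. -/
def ChanP (Pf : AdmissibleFamily) (A : FdSubalgebra ι) (B : FdSubalgebra κ) : Set (HMap ι κ) :=
  {φ | φ ∈ PL Pf A B ∧ TP φ}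

/-- The dual cone `Pf*(A,B) = Pf*(H,K) ∩ L(A,B)`, where `Pf*(H,K) ⊆ L(H,K)` is the dual cone
of `Pf(K,H)` with respect to the pairing `⟨·,·⟩`. -/
def PstarL (Pf : AdmissibleFamily) (A : FdSubalgebra ι) (B : FdSubalgebra κ) :
    Set (HMap ι κ) :=
  {ψ | IsHermMap ψ ∧ ψ ∈ LAB A B ∧ ∀ χ ∈ Pf.P κ ι, 0 ≤ pairing ψ χ}

/-- The diamond norm `‖φ‖_◇ = inf{λ>0 : ∃ α ∈ 𝒞(A,B), λα ± φ ∈ Pf(A,B)}`. -/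
def dnormP (Pf : AdmissibleFamily) (A : FdSubalgebra ι) (B : FdSubalgebra κ)
    (φ : HMap ι κ) : ℝ :=
  sInf {l : ℝ | 0 < l ∧ ∃ α ∈ ChanP Pf A B,
    (l • α - φ) ∈ PL Pf A B ∧ (l • α + φ) ∈ PL Pf A B}

/-- The dual diamond norm `‖φ‖^◇ = inf{λ>0 : ∃ σ ∈ 𝔖(B), λ Φ_{I,σ} ± φ ∈ Pf*(A,B)}`. -/
def udnormP (Pf : AdmissibleFamily) (A : FdSubalgebra ι) (B : FdSubalgebra κ)
    (φ : HMap ι κ) : ℝ :=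
  sInf {l : ℝ | 0 < l ∧ ∃ σ ∈ States B,
    (l • PhiI ι σ - φ) ∈ PstarL Pf A B ∧ (l • PhiI ι σ + φ) ∈ PstarL Pf A B}

/-- `CP(A,B) = CP(H,K) ∩ L(A,B)`. -/
def CPL (A : FdSubalgebra ι) (B : FdSubalgebra κ) : Set (HMap ι κ) :=
  CPSet ι κ ∩ LAB A B

/-- Completely positive trace preserving channels `A → B`. -/
def ChanCP (A : FdSubalgebra ι) (B : FdSubalgebra κ) : Set (HMap ι κ) :=
  {φ | φ ∈ CPL A B ∧ TP φ}

/-- The dual diamond norm with respect to the family `CP` (recall `CP* = CP`). -/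
def udnormCP (A : FdSubalgebra ι) (B : FdSubalgebra κ) (φ : HMap ι κ) : ℝ :=
  sInf {l : ℝ | 0 < l ∧ ∃ σ ∈ States B,
    (l • PhiI ι σ - φ) ∈ CPL A B ∧ (l • PhiI ι σ + φ) ∈ CPL A B}

/-- The qc-map `Φ^qc_A : b ↦ ∑_i Tr(A_i b) |e_i⟩⟨e_i|` given by operators `A_1, …, A_n`. -/
def PhiQC {n : ℕ} (A : Fin n → Mat ι) : HMap ι (Fin n) :=
  fun b => Matrix.diagonal fun i => (A i * b).trace

/-- The cq-map `Φ^cq_A : x ↦ ∑_i ⟨e_i, x e_i⟩ A_i` given by operators `A_1, …, A_n`. -/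
def PhiCQ {n : ℕ} (A : Fin n → Mat ι) : HMap (Fin n) ι :=
  fun x => ∑ i, x i i • A i

/-- The trace norm `‖A‖₁ = Tr √(AᴴA)`. -/
def traceNorm (A : Mat ι) : ℝ :=
  ((Matrix.posSemidef_conjTranspose_mul_self A).sqrt.trace).re

/-- The operator norm of a matrix. -/
def opNorm (A : Mat ι) : ℝ := ‖Matrix.toEuclideanCLM (𝕜 := ℂ) A‖

/-- The cone `C(~Pf(H,K)) ⊆ B_h(K ⊗ H)` of Choi matrices of adjoints of maps in the dual cone
`Pf*(K,H)`. -/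
def tildeCone (Pf : AdmissibleFamily) (ι κ : Type) [Fintype ι] [DecidableEq ι]
    [Fintype κ] [DecidableEq κ] : Set (Mat (κ × ι)) :=
  {X | ∃ ψ : HMap κ ι, IsHermMap ψ ∧ (∀ χ ∈ Pf.P ι κ, 0 ≤ pairing χ ψ) ∧
    X = Choi (adjFun ψ)}

/-- The base norm `‖X‖_{1,~Pf} = sup{Tr XY : -I ≤_{~Pf} Y ≤_{~Pf} I}` on `B_h(K ⊗ H)`. -/
def oneNormTilde (Pf : AdmissibleFamily) (X : Mat (κ × ι)) : ℝ :=
  sSup {r : ℝ | ∃ Y : Mat (κ × ι), (1 - Y) ∈ tildeCone Pf ι κ ∧ (1 + Y) ∈ tildeCone Pf ι κ ∧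
    r = ((X * Y).trace).re}

/-- The order unit norm `‖X‖_C = inf{λ>0 : -λ1 ≤_C X ≤_C λ1}` for a cone `C` of matrices. -/
def ordUnitNorm {α : Type} [Fintype α] [DecidableEq α] (C : Set (Mat α)) (X : Mat α) : ℝ :=
  sInf {l : ℝ | 0 < l ∧ (l • (1 : Mat α) - X) ∈ C ∧ (l • (1 : Mat α) + X) ∈ C}

open Classical in
/-- `(σ + ε I)^{-1/2}`. -/
def invSqrtShift (σ : Mat κ) (ε : ℝ) : Mat κ :=
  if h : (σ + (ε : ℂ) • 1).PosSemidef then h.sqrt⁻¹ else 0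

variable {κ' δ : Type} [Fintype κ'] [DecidableEq κ'] [Fintype δ] [DecidableEq δ]

/-- `Ψ` is `(ε,D)`-post-processing deficient with respect to `Φ` (relative to the family `Pf`):
for every payoff map `Γ ∈ Pf*(D,A)` and every `α ∈ 𝒞(B,D)` there is `α' ∈ 𝒞(B',D)` with
`⟨α∘Φ,Γ⟩ ≤ ⟨α'∘Ψ,Γ⟩ + ε‖Γ‖^◇`. -/
def PostDeficientP (Pf : AdmissibleFamily) (A : FdSubalgebra ι) (B : FdSubalgebra κ)
    (B' : FdSubalgebra κ') (D : FdSubalgebra δ) (Φ : HMap ι κ) (Ψ : HMap ι κ') (ε : ℝ) :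
    Prop :=
  ∀ Γ ∈ PstarL Pf D A, ∀ α ∈ ChanP Pf B D, ∃ α' ∈ ChanP Pf B' D,
    pairing (α ∘ Φ) Γ ≤ pairing (α' ∘ Ψ) Γ + ε * udnormP Pf D A Γ

/-- Post-processing deficiency for the admissible family `CP` (recall `CP* = CP`). -/
def PostDeficientCP (A : FdSubalgebra ι) (B : FdSubalgebra κ)
    (B' : FdSubalgebra κ') (D : FdSubalgebra δ) (Φ : HMap ι κ) (Ψ : HMap ι κ') (ε : ℝ) :
    Prop :=
  ∀ Γ ∈ CPL D A, ∀ α ∈ ChanCP B D, ∃ α' ∈ ChanCP B' D,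
    pairing (α ∘ Φ) Γ ≤ pairing (α' ∘ Ψ) Γ + ε * udnormCP D A Γ

variable {ι' : Type} [Fintype ι'] [DecidableEq ι']

/-- `Ψ` is `(ε,D)`-pre-processing deficient with respect to `Φ` (relative to `Pf`). -/
def PreDeficientP (Pf : AdmissibleFamily) (A : FdSubalgebra ι) (A' : FdSubalgebra ι')
    (B : FdSubalgebra κ) (D : FdSubalgebra δ) (Φ : HMap ι κ) (Ψ : HMap ι' κ) (ε : ℝ) :
    Prop :=
  ∀ Γ ∈ PstarL Pf B D, ∀ β ∈ ChanP Pf D A, ∃ β' ∈ ChanP Pf D A',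
    pairing (Φ ∘ β) Γ ≤ pairing (Ψ ∘ β') Γ + ε * udnormP Pf B D Γ

/-- Pre-processing deficiency for the admissible family `CP`. -/
def PreDeficientCP (A : FdSubalgebra ι) (A' : FdSubalgebra ι') (B : FdSubalgebra κ)
    (D : FdSubalgebra δ) (Φ : HMap ι κ) (Ψ : HMap ι' κ) (ε : ℝ) : Prop :=
  ∀ Γ ∈ CPL B D, ∀ β ∈ ChanCP D A, ∃ β' ∈ ChanCP D A',
    pairing (Φ ∘ β) Γ ≤ pairing (Ψ ∘ β') Γ + ε * udnormCP B D Γ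

/-- `Ψ ⊇_ε Φ`: `sup_{σ ∈ SA} inf_{ρ ∈ SA'} ‖f(σ) - g(ρ)‖₁ ≤ 2ε`. -/
def SupsetCond {α α' β : Type} [Fintype β] [DecidableEq β] (SA : Set (Mat α)) (SA' : Set (Mat α'))
    (f : Mat α → Mat β) (g : Mat α' → Mat β) (ε : ℝ) : Prop :=
  sSup {r : ℝ | ∃ σ ∈ SA, r = sInf {t : ℝ | ∃ ρ ∈ SA', t = traceNorm (f σ - g ρ)}} ≤ 2 * ε

end Main


section Helpers
set_option linter.unusedSectionVars false
variable {ι κ μ : Type} [Fintype ι] [DecidableEq ι] [Fintype κ] [DecidableEq κ]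
  [Fintype μ] [DecidableEq μ]

open scoped Matrix.Norms.L2Operator MatrixOrder in
lemma aux_sqrt {p : Mat ι} (hp : p.PosSemidef) : ∃ B : Mat ι, p = Bᴴ * B :=
  CStarAlgebra.nonneg_iff_eq_star_mul_self.mp hp.nonneg

lemma aux_cp_of_kraus (W : μ → Matrix κ ι ℂ) :
    (fun a : Mat ι => ∑ m, W m * a * (W m)ᴴ) ∈ CPSet ι κ := by
  refine ⟨⟨⟨?_, ?_⟩, ?_⟩, ?_⟩
  · intro x y
    simp [Matrix.mul_add, Matrix.add_mul, Finset.sum_add_distrib]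
  · intro c x
    simp [Finset.smul_sum]
  · intro a
    simp [Matrix.conjTranspose_sum, Matrix.mul_assoc]
  · intro n M hM
    have : tensorId (fun a : Mat ι => ∑ m, W m * a * (W m)ᴴ) (Fin n) M
        = ∑ m, (W m ⊗ₖ (1 : Mat (Fin n))) * M * (W m ⊗ₖ (1 : Mat (Fin n)))ᴴ := by
      ext ⟨k, c⟩ ⟨l, d⟩
      simp only [tensorId, Matrix.of_apply, Matrix.sum_apply]
      refine Finset.sum_congr rfl fun m _ => ?_
      simp only [Matrix.mul_apply, Matrix.conjTranspose_apply, Matrix.kroneckerMap_apply,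
        Fintype.sum_prod_type, Matrix.of_apply, Matrix.one_apply]
      simp [apply_ite]
    rw [this]
    exact Matrix.posSemidef_sum _ fun m _ => hM.mul_mul_conjTranspose_same _

lemma aux_expand {φ : HMap ι κ} (h : IsLinearMap ℂ φ) (a : Mat ι) :
    φ a = ∑ i, ∑ j, a i j • φ (Matrix.single i j 1) := by
  have h2 := h
  let f : Mat ι →ₗ[ℂ] Mat κ := h2.mk' φ
  have hf : ∀ x, f x = φ x := fun _ => rfl
  conv_lhs => rw [Matrix.matrix_eq_sum_single a, ← hf]
  simp only [map_sum]
  refine Finset.sum_congr rfl fun i _ => Finset.sum_congr rfl fun j _ => ?_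
  rw [← hf, ← map_smul]
  simp

lemma aux_cp_of_choi {φ : HMap ι κ} (h : IsLinearMap ℂ φ) (hC : (Choi φ).PosSemidef) :
    φ ∈ CPSet ι κ := by
  obtain ⟨B, hB⟩ := aux_sqrt hC
  have : φ = fun a : Mat ι => ∑ m, (Matrix.of fun k i => star (B m (k, i))) * a *
      (Matrix.of fun k i => star (B m (k, i)))ᴴ := by
    funext a
    rw [aux_expand h a]
    ext k l
    have hc : ∀ i j, φ (Matrix.single i j 1) k l = ∑ m, star (B m (k, i)) * B m (l, j) := by
      intro i j
      have := congrFun (congrFun hB (k, i)) (l, j)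
      simpa [Choi, Matrix.mul_apply] using this
    simp only [Matrix.sum_apply, Matrix.smul_apply, hc, smul_eq_mul, Matrix.mul_apply,
      Matrix.of_apply, Matrix.conjTranspose_apply, star_star, Finset.mul_sum, Finset.sum_mul]
    rw [Finset.sum_comm]
    conv_rhs => rw [Finset.sum_comm]
    refine Finset.sum_congr rfl fun j _ => ?_
    rw [Finset.sum_comm]
    refine Finset.sum_congr rfl fun m _ => Finset.sum_congr rfl fun i _ => ?_
    ring
  rw [this]
  exact aux_cp_of_kraus _

lemma aux_choi_herm {φ : HMap ι κ} (h : IsHermMap φ) : (Choi φ).IsHermitian := by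
  ext ⟨k, i⟩ ⟨l, j⟩
  have := congrFun (congrFun (h.2 (Matrix.single i j 1)) l) k
  simp [Choi] at this ⊢
  rw [this]; simp

lemma aux_cp_dual {ψ : HMap ι κ} (h : IsHermMap ψ)
    (hd : ∀ χ ∈ CPSet κ ι, 0 ≤ pairing ψ χ) : ψ ∈ CPSet ι κ := by
  refine aux_cp_of_choi h.1 (Matrix.PosSemidef.of_dotProduct_mulVec_nonneg (aux_choi_herm h) ?_)
  intro x
  have hre : (star x ⬝ᵥ (Choi ψ) *ᵥ x).im = 0 := (aux_choi_herm h).im_star_dotProduct_mulVec_self x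
  have h1 := hd _ (aux_cp_of_kraus (fun _ : Unit => (Matrix.of fun i k => star (x (k, i)))))
  have h2 : pairing ψ (fun a : Mat κ => ∑ m : Unit, (Matrix.of fun i k => star (x (k, i))) * a *
      (Matrix.of fun i k => star (x (k, i)))ᴴ) = (star x ⬝ᵥ (Choi ψ) *ᵥ x).re := by
    unfold pairing sC
    congr 1
    simp only [Function.comp, Matrix.mul_apply, Matrix.conjTranspose_apply, Matrix.of_apply,
      dotProduct, Matrix.mulVec, Fintype.sum_prod_type, Choi, Finset.sum_mul, Finset.mul_sum,
      Matrix.sum_apply, Finset.univ_unique, Finset.sum_singleton, star_star, Pi.star_apply]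
    conv_rhs => rw [Finset.sum_comm]
    refine Finset.sum_congr rfl fun i _ => ?_
    rw [Finset.sum_comm]
    conv_rhs => rw [Finset.sum_comm]
    refine Finset.sum_congr rfl fun l _ => ?_
    rw [Finset.sum_comm]
    refine Finset.sum_congr rfl fun k _ => Finset.sum_congr rfl fun j _ => ?_
    ring
  rw [h2] at h1
  exact Complex.nonneg_iff.mpr ⟨h1, hre.symm⟩

open scoped Matrix.Norms.L2Operator MatrixOrder in
lemma aux_shift {h : Mat ι} (hh : h.IsHermitian) :
    ∃ c : ℝ, 0 ≤ c ∧ (c • (1 : Mat ι) + h).PosSemidef ∧ (c • (1 : Mat ι) - h).PosSemidef := by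
  refine ⟨‖h‖, norm_nonneg _, ?_, ?_⟩
  · have := IsSelfAdjoint.neg_algebraMap_norm_le_self (a := h) hh
    rw [Matrix.le_iff] at this
    simpa [Algebra.algebraMap_eq_smul_one, add_comm] using this
  · have := IsSelfAdjoint.le_algebraMap_norm_self (a := h) hh
    rw [Matrix.le_iff] at this
    simpa [Algebra.algebraMap_eq_smul_one] using this

lemma aux_E_herm (A : FdSubalgebra ι) (x : Mat ι) : A.E xᴴ = (A.E x)ᴴ := by
  have key : ∀ y ∈ A.car, ((A.E xᴴ - (A.E x)ᴴ) * y).trace = 0 := by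
    intro y hy
    rw [Matrix.sub_mul, Matrix.trace_sub, A.E_trace _ _ hy, sub_eq_zero]
    have h1 := congrArg star (A.E_trace x yᴴ (A.star_mem hy))
    rw [← Matrix.trace_conjTranspose, ← Matrix.trace_conjTranspose] at h1
    simp only [Matrix.conjTranspose_mul, Matrix.conjTranspose_conjTranspose] at h1
    rw [Matrix.trace_mul_comm, ← h1, Matrix.trace_mul_comm]
  have hd : A.E xᴴ - (A.E x)ᴴ ∈ A.car := by
    have := A.add_mem (A.E_mem xᴴ) (A.smul_mem (-1) (A.star_mem (A.E_mem x)))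
    simpa [sub_eq_add_neg] using this
  have := key _ (A.star_mem hd)
  rw [Matrix.trace_mul_conjTranspose_self_eq_zero_iff] at this
  exact sub_eq_zero.mp this

lemma aux_E_pos (A : FdSubalgebra ι) {x : Mat ι} (hx : x.PosSemidef) : (A.E x).PosSemidef := by
  have hy : (A.E x).IsHermitian := by
    rw [Matrix.IsHermitian, ← aux_E_herm, hx.1]
  set y := A.E x with hydef
  let ev := hy.eigenvalues
  let U : Mat ι := hy.eigenvectorUnitary
  have hUU : U * star U = 1 := by simp [U]
  have hUU' : star U * U = 1 := by simp [U]
  have hyU : y = U * Matrix.diagonal (fun i => (ev i : ℂ)) * star U := by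
    have := hy.spectral_theorem
    simpa [Unitary.conjStarAlgAut_apply, Function.comp_def] using this
  have hmem : ∀ q : Polynomial ℂ, ∃ z ∈ A.car,
      z = U * Matrix.diagonal (fun i => q.eval (ev i : ℂ)) * star U := by
    intro q
    induction q using Polynomial.induction_on' with
    | add p q hp hq =>
      obtain ⟨a, ha, rfl⟩ := hp
      obtain ⟨b, hb, rfl⟩ := hq
      refine ⟨_, A.add_mem ha hb, ?_⟩
      rw [← Matrix.add_mul, ← Matrix.mul_add, Matrix.diagonal_add]
      simp
    | monomial n c =>
      have hp : ∀ n : ℕ, U * Matrix.diagonal (fun i => (ev i : ℂ) ^ n) * star U ∈ A.car := by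
        intro n
        induction n with
        | zero =>
          have : U * Matrix.diagonal (fun i => (ev i : ℂ) ^ 0) * star U = 1 := by simpa using hUU
          rw [this]; exact A.one_mem
        | succ n ih =>
          have := A.mul_mem ih (A.E_mem x)
          rw [← hydef, hyU] at this
          convert this using 1
          have e : (Matrix.diagonal fun i => (ev i : ℂ) ^ (n+1))
            = Matrix.diagonal (fun i => (ev i : ℂ) ^ n) * (star U * U) *
              Matrix.diagonal (fun i => (ev i : ℂ)) := by
            rw [hUU']; simp [pow_succ]
          rw [e]; simp only [Matrix.mul_assoc]
      refine ⟨_, A.smul_mem c (hp n), ?_⟩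
      rw [← Matrix.smul_mul, ← Matrix.mul_smul, ← Matrix.diagonal_smul]
      simp [Pi.smul_def]
  rw [hy.posSemidef_iff_eigenvalues_nonneg]
  intro i0
  by_contra hneg
  have hneg : ev i0 < 0 := by simpa using hneg
  -- the spectral projection
  obtain ⟨z, hz, hzq⟩ := hmem (Lagrange.interpolate (Finset.univ.image ev) (fun r : ℝ => (r : ℂ))
    (fun r => if r < 0 then 1 else 0))
  have hq : ∀ i, (Lagrange.interpolate (Finset.univ.image ev) (fun r : ℝ => (r : ℂ))
    (fun r => if r < 0 then (1 : ℂ) else 0)).eval (ev i : ℂ) = if ev i < 0 then 1 else 0 := by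
    intro i
    exact Lagrange.eval_interpolate_at_node _ (Complex.ofReal_injective.injOn) (by simp)
  simp only [hq] at hzq
  have hzz : z * zᴴ = z := by
    rw [hzq]
    simp only [Matrix.conjTranspose_mul, Matrix.diagonal_conjTranspose, Matrix.star_eq_conjTranspose,
      Matrix.conjTranspose_conjTranspose]
    rw [Matrix.star_eq_conjTranspose] at hUU'
    have : ∀ P Q : Mat ι, U * P * Uᴴ * (U * (Q * Uᴴ)) = U * (P * (Uᴴ * U) * Q) * Uᴴ := by
      intro P Q; simp only [Matrix.mul_assoc]
    rw [this, hUU', Matrix.mul_one, Matrix.diagonal_mul_diagonal]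
    congr 3
    funext i
    simp; 
  have h1 := A.E_trace x z hz
  have h2 : 0 ≤ (x * z).trace := by
    rw [← hzz, ← Matrix.mul_assoc, Matrix.trace_mul_comm, ← Matrix.mul_assoc]
    exact (hx.conjTranspose_mul_mul_same z).trace_nonneg
  rw [← h1, ← hydef, hyU, hzq] at h2
  have h3 : (U * Matrix.diagonal (fun i => (ev i : ℂ)) * star U *
      (U * Matrix.diagonal (fun i => if ev i < 0 then (1:ℂ) else 0) * star U)).trace
      = ((∑ i, if ev i < 0 then ev i else 0 : ℝ) : ℂ) := by
    have : ∀ P Q : Mat ι, U * P * star U * (U * Q * star U) = U * (P * (star U * U) * Q) * star U := by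
      intro P Q; simp only [Matrix.mul_assoc]
    rw [this, hUU', Matrix.mul_one, Matrix.trace_mul_comm, ← Matrix.mul_assoc, hUU', Matrix.one_mul,
      Matrix.diagonal_mul_diagonal, Matrix.trace_diagonal]
    push_cast
    refine Finset.sum_congr rfl fun i _ => ?_
    split_ifs <;> simp
  rw [h3, Complex.zero_le_real] at h2
  have h4 : (∑ i, if ev i < 0 then ev i else 0 : ℝ) < 0 := by
    refine Finset.sum_neg' (fun i _ => ?_) ⟨i0, Finset.mem_univ _, by simp [hneg]⟩
    split_ifs with h
    · exact h.le
    · exact le_rfl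
  linarith

lemma aux_E_chan (A : FdSubalgebra ι) : A.E ∈ ChanCP A A := by
  refine ⟨⟨⟨⟨A.E_linear, aux_E_herm A⟩, ?_⟩, A.E_mem, fun a => A.E_fix _ (A.E_mem a)⟩, ?_⟩
  · intro n M hM
    exact aux_E_pos (A.tensorFull (Fin n)) hM
  · intro a
    simpa using A.E_trace a 1 A.one_mem

lemma aux_id_cp : (id : HMap ι ι) ∈ CPSet ι ι :=
  ⟨⟨⟨fun _ _ => rfl, fun _ _ => rfl⟩, fun _ => rfl⟩, fun _ _ hM => hM⟩

lemma aux_choi_phi : Choi (PhiI ι (1 : Mat κ)) = 1 := by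
  ext ⟨k, i⟩ ⟨l, j⟩
  by_cases h : i = j
  · subst h
    simp [Choi, PhiI, Matrix.one_apply]
  · simp [Choi, PhiI, Matrix.one_apply, h]

lemma aux_phi_herm {σ : Mat κ} (hσ : σ.IsHermitian) : IsHermMap (PhiI ι σ) := by
  refine ⟨⟨?_, ?_⟩, ?_⟩
  · intro x y; simp [PhiI, add_smul]
  · intro c x; simp [PhiI, mul_smul]
  · intro a; simp [PhiI, Matrix.conjTranspose_smul, hσ.eq]

lemma aux_herm_add {φ ψ : HMap ι κ} (h1 : IsHermMap φ) (h2 : IsHermMap ψ) : IsHermMap (φ + ψ) := by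
  refine ⟨⟨?_, ?_⟩, ?_⟩
  · intro x y; simp [h1.1.map_add, h2.1.map_add]; abel
  · intro c x; simp [h1.1.map_smul, h2.1.map_smul]
  · intro a; simp [h1.2, h2.2]

lemma aux_herm_smul {φ : HMap ι κ} (h1 : IsHermMap φ) (c : ℝ) : IsHermMap (c • φ) := by
  refine ⟨⟨?_, ?_⟩, ?_⟩
  · intro x y; simp [h1.1.map_add]
  · intro a x; simp [h1.1.map_smul, smul_comm c a]
  · intro a; simp [h1.2]

lemma aux_herm_comp {φ : HMap ι κ} {ψ : HMap κ μ} (h1 : IsHermMap φ) (h2 : IsHermMap ψ) :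
    IsHermMap (ψ ∘ φ) := by
  refine ⟨⟨?_, ?_⟩, ?_⟩
  · intro x y; simp [h1.1.map_add, h2.1.map_add]
  · intro a x; simp [h1.1.map_smul, h2.1.map_smul]
  · intro a; simp [h1.2, h2.2]

lemma aux_cp_shift {φ : HMap ι κ} (h : IsHermMap φ) :
    ∃ c : ℝ, (c • PhiI ι (1 : Mat κ) + φ) ∈ CPSet ι κ := by
  obtain ⟨c, -, hc, -⟩ := aux_shift (aux_choi_herm h)
  refine ⟨c, aux_cp_of_choi (aux_herm_add (aux_herm_smul (aux_phi_herm Matrix.isHermitian_one) c) h).1 ?_⟩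
  rw [← aux_choi_phi] at hc
  exact hc

lemma aux_entry {p : Mat ι} (hp : p.PosSemidef) (k l : ι) : ‖p k l‖ ≤ p.trace.re := by
  obtain ⟨B, rfl⟩ := aux_sqrt hp
  have hd : ∀ k, ((Bᴴ * B) k k).re = ∑ m, ‖B m k‖ ^ 2 := by
    intro k
    simp only [Matrix.mul_apply, Matrix.conjTranspose_apply, Complex.re_sum]
    refine Finset.sum_congr rfl fun m _ => ?_
    have : star (B m k) * B m k = ((‖B m k‖ ^ 2 : ℝ) : ℂ) := by
      rw [Complex.star_def, Complex.conj_mul']; simp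
    rw [this, Complex.ofReal_re]
  have htr : ∀ k, ∑ m, ‖B m k‖ ^ 2 ≤ (Bᴴ * B).trace.re := by
    intro k
    rw [Matrix.trace, Complex.re_sum]
    simp only [Matrix.diag, hd]
    exact Finset.single_le_sum (f := fun k => ∑ m, ‖B m k‖ ^ 2)
      (fun i _ => Finset.sum_nonneg fun m _ => by positivity) (Finset.mem_univ k)
  have h1 : ‖(Bᴴ * B) k l‖ ≤ ∑ m, (‖B m k‖ ^ 2 + ‖B m l‖ ^ 2) / 2 := by
    rw [Matrix.mul_apply]
    refine (norm_sum_le _ _).trans (Finset.sum_le_sum fun m _ => ?_)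
    rw [norm_mul, Matrix.conjTranspose_apply, norm_star]
    nlinarith [sq_nonneg (‖B m k‖ - ‖B m l‖)]
  rw [← Finset.sum_div, Finset.sum_add_distrib] at h1
  linarith [htr k, htr l]

lemma aux_pos_bound_herm {h : Mat ι} (hh : h.IsHermitian) :
    ∃ c : ℝ, 0 ≤ c ∧ ∀ χ ∈ PosSet ι κ, ∀ k l, ‖χ h k l‖ ≤ c * (χ 1).trace.re := by
  obtain ⟨c, hc0, h1, h2⟩ := aux_shift hh
  refine ⟨c, hc0, fun χ hχ k l => ?_⟩
  have e1 := aux_entry (hχ.2 _ h1) k l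
  have e2 := aux_entry (hχ.2 _ h2) k l
  have hs : χ (c • (1 : Mat ι)) = (c : ℂ) • χ 1 := by
    rw [← hχ.1.1.map_smul]; congr 1
  rw [hχ.1.1.map_add, hs] at e1
  rw [hχ.1.1.map_sub, hs] at e2
  have e3 : (2:ℂ) * χ h k l = ((c : ℂ) • χ 1 + χ h) k l - ((c : ℂ) • χ 1 - χ h) k l := by
    simp; ring
  have e4 : 2 * ‖χ h k l‖ ≤ ‖((c : ℂ) • χ 1 + χ h) k l‖ + ‖((c : ℂ) • χ 1 - χ h) k l‖ := by
    have := norm_sub_le (((c : ℂ) • χ 1 + χ h) k l) (((c : ℂ) • χ 1 - χ h) k l)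
    rw [← e3, norm_mul] at this
    simpa using this
  simp [Matrix.trace_add, Matrix.trace_sub, Matrix.trace_smul] at e1 e2
  simp at e4
  linarith

lemma aux_pos_bound (a : Mat ι) :
    ∃ c : ℝ, 0 ≤ c ∧ ∀ χ ∈ PosSet ι κ, ∀ k l, ‖χ a k l‖ ≤ c * (χ 1).trace.re := by
  have H1 : (a + aᴴ).IsHermitian := by simp [Matrix.IsHermitian, add_comm]
  have H2 : (Complex.I • (a - aᴴ)).IsHermitian := by
    simp [Matrix.IsHermitian, Matrix.conjTranspose_smul, ← smul_neg]
  obtain ⟨c, hc0, h1⟩ := aux_pos_bound_herm (κ := κ) H1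
  obtain ⟨d, hd0, h2⟩ := aux_pos_bound_herm (κ := κ) H2
  refine ⟨c + d, by positivity, fun χ hχ k l => ?_⟩
  have e1 := h1 χ hχ k l
  have e2 := h2 χ hχ k l
  rw [hχ.1.1.map_add] at e1
  rw [hχ.1.1.map_smul, hχ.1.1.map_sub, Matrix.smul_apply, norm_smul, Complex.norm_I, one_mul] at e2
  have e3 : (2:ℂ) * χ a k l = (χ a + χ aᴴ) k l + (χ a - χ aᴴ) k l := by
    simp; ring
  have e4 : 2 * ‖χ a k l‖ ≤ ‖(χ a + χ aᴴ) k l‖ + ‖(χ a - χ aᴴ) k l‖ := by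
    have := norm_add_le ((χ a + χ aᴴ) k l) ((χ a - χ aᴴ) k l)
    rw [← e3, norm_mul] at this
    simpa using this
  have := norm_nonneg (χ a k l)
  nlinarith

lemma aux_pairing_bound (Γ : HMap ι κ) :
    ∃ c : ℝ, 0 ≤ c ∧ ∀ χ ∈ PosSet κ ι, |pairing Γ χ| ≤ c * (χ 1).trace.re := by
  choose c hc0 hc using fun a : Mat κ => aux_pos_bound (κ := ι) a
  refine ⟨∑ i, ∑ j, c (Γ (Matrix.single i j 1)), Finset.sum_nonneg fun i _ =>
    Finset.sum_nonneg fun j _ => hc0 _, fun χ hχ => ?_⟩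
  refine (Complex.abs_re_le_norm _).trans ?_
  unfold sC
  refine (norm_sum_le _ _).trans ?_
  rw [Finset.sum_mul]
  refine Finset.sum_le_sum fun i _ => ?_
  refine (norm_sum_le _ _).trans ?_
  rw [Finset.sum_mul]
  exact Finset.sum_le_sum fun j _ => hc _ χ hχ i j

lemma aux_pairing_phi {χ : HMap κ ι} (hχ : IsLinearMap ℂ χ) (σ : Mat κ) :
    pairing (PhiI ι σ) χ = (χ σ).trace.re := by
  unfold pairing sC
  congr 1
  rw [Matrix.trace]
  refine Finset.sum_congr rfl fun i _ => ?_
  rw [Finset.sum_eq_single i]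
  · simp [PhiI]
  · intro j _ hj
    simp [PhiI, Matrix.trace_single_eq_of_ne _ _ _ hj.symm, hχ.map_zero]
  · simp

lemma aux_pairing_add {χ : HMap κ ι} (hχ : IsLinearMap ℂ χ) (φ ψ : HMap ι κ) :
    pairing (φ + ψ) χ = pairing φ χ + pairing ψ χ := by
  simp [pairing, sC, hχ.map_add, Finset.sum_add_distrib]

lemma aux_pairing_smul {χ : HMap κ ι} (hχ : IsLinearMap ℂ χ) (c : ℝ) (φ : HMap ι κ) :
    pairing (c • φ) χ = c * pairing φ χ := by
  have : ∀ x, χ (c • x) = (c : ℂ) • χ x := by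
    intro x; rw [← hχ.map_smul]; congr 1
  simp [pairing, sC, this, Finset.mul_sum]

/-- Adding a multiple of `PhiI 1` on the payoff side shifts the pairing by a constant. -/
lemma aux_pairing_shift (φ : HMap ι κ) (hφ : TP φ) (Γ : HMap κ ι) (c : ℝ) :
    pairing φ (c • PhiI κ (1 : Mat ι) + Γ) = c * Fintype.card ι + pairing φ Γ := by
  simp only [pairing, sC, Function.comp, Pi.add_apply, Pi.smul_apply, Matrix.add_apply,
    Finset.sum_add_distrib, Complex.add_re]
  congr 1
  have : ∀ i j : ι, (c • PhiI κ (1 : Mat ι) (φ (Matrix.single i j 1))) i j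
      = if i = j then (c : ℂ) else 0 := by
    intro i j
    by_cases h : i = j
    · subst h; simp [PhiI, hφ _]
    · simp [PhiI, h]
  simp [this, mul_comm]

lemma aux_sum4 (G : ι → ι → κ → κ → ℂ) :
    ∑ i, ∑ j, ∑ k, ∑ l, G i j k l = ∑ k, ∑ l, ∑ i, ∑ j, G i j k l := by
  calc ∑ i, ∑ j, ∑ k, ∑ l, G i j k l = ∑ i, ∑ k, ∑ j, ∑ l, G i j k l :=
        Finset.sum_congr rfl fun i _ => Finset.sum_comm
    _ = ∑ k, ∑ i, ∑ j, ∑ l, G i j k l := Finset.sum_comm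
    _ = ∑ k, ∑ i, ∑ l, ∑ j, G i j k l :=
        Finset.sum_congr rfl fun k _ => Finset.sum_congr rfl fun i _ => Finset.sum_comm
    _ = _ := Finset.sum_congr rfl fun k _ => Finset.sum_comm

/-- cyclicity of the pairing -/
lemma aux_trace_form {φ : HMap ι κ} {ψ : HMap κ ι} (h1 : IsLinearMap ℂ φ) (h2 : IsLinearMap ℂ ψ) :
    pairing φ ψ = pairing ψ φ := by
  unfold pairing sC
  congr 1
  have e1 : ∀ i j, (ψ ∘ φ) (Matrix.single i j 1) i j
      = ∑ k, ∑ l, φ (Matrix.single i j 1) k l * ψ (Matrix.single k l 1) i j := by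
    intro i j
    simp only [Function.comp]
    conv_lhs => rw [aux_expand h2]
    simp [Matrix.sum_apply]
  have e2 : ∀ k l, (φ ∘ ψ) (Matrix.single k l 1) k l
      = ∑ i, ∑ j, φ (Matrix.single i j 1) k l * ψ (Matrix.single k l 1) i j := by
    intro i j
    simp only [Function.comp]
    conv_lhs => rw [aux_expand h1]
    simp [Matrix.sum_apply, mul_comm]
  simp only [e1, e2]
  exact aux_sum4 _

variable {κ' δ : Type} [Fintype κ'] [DecidableEq κ'] [Fintype δ] [DecidableEq δ]

lemma aux_chan_comp (Pf : AdmissibleFamily) {B : FdSubalgebra κ} {B' : FdSubalgebra κ'}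
    {D : FdSubalgebra δ} {α : HMap κ δ} (hα : α ∈ ChanP Pf B D) {β : HMap κ' κ}
    (hβ : β ∈ ChanCP B' B) : α ∘ β ∈ ChanP Pf B' D := by
  refine ⟨⟨?_, ?_, ?_⟩, ?_⟩
  · exact Pf.cp_comp_mem κ' κ δ δ β hβ.1.1 α hα.1.1 id aux_id_cp
  · intro a; exact hα.1.2.1 _
  · intro a; simp [hβ.1.2.2 a]
  · intro a; simp only [Function.comp]; rw [hα.2, hβ.2]

lemma aux_star_comp (Pf : AdmissibleFamily) {A : FdSubalgebra ι} {B : FdSubalgebra κ}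
    {D : FdSubalgebra δ} {α : HMap κ δ} (hα : α ∈ ChanP Pf B D) {Γ : HMap δ ι}
    (hΓ : Γ ∈ PstarL Pf D A) : Γ ∘ α ∈ PstarL Pf B A := by
  have hαh := (Pf.le_pos _ _ hα.1.1).1
  refine ⟨aux_herm_comp hαh hΓ.1, ⟨fun a => hΓ.2.1.1 _, fun a => ?_⟩, fun χ hχ => ?_⟩
  · simp [hα.1.2.2 a]
  · have h := hΓ.2.2 _ (Pf.comp_mem _ _ _ χ hχ α hα.1.1)
    have hχh := (Pf.le_pos _ _ hχ).1
    have := aux_trace_form hαh.1 (aux_herm_comp hΓ.1 hχh).1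
    change 0 ≤ pairing α (χ ∘ Γ)
    rw [this]
    exact h

lemma aux_star_cp (Pf : AdmissibleFamily) (hcp : CPSet ι κ ⊆ Pf.P ι κ) {A : FdSubalgebra ι}
    {B : FdSubalgebra κ} {Γ : HMap κ ι} (hΓ : Γ ∈ PstarL Pf B A) : Γ ∈ CPL B A :=
  ⟨aux_cp_dual hΓ.1 fun χ hχ => hΓ.2.2 χ (hcp hχ), hΓ.2.1⟩

lemma aux_norm_nonempty [Nonempty ι] (Pf : AdmissibleFamily) {A : FdSubalgebra ι}
    {D : FdSubalgebra δ} {Γ : HMap δ ι} (hΓ : Γ ∈ PstarL Pf D A) :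
    {l : ℝ | 0 < l ∧ ∃ σ ∈ States A,
      (l • PhiI δ σ - Γ) ∈ PstarL Pf D A ∧ (l • PhiI δ σ + Γ) ∈ PstarL Pf D A}.Nonempty := by
  obtain ⟨c, hc0, hc⟩ := aux_pairing_bound Γ
  have hn : (0 : ℝ) < Fintype.card ι := by exact_mod_cast Fintype.card_pos
  set n : ℝ := (Fintype.card ι : ℝ) with hndef
  set σ : Mat ι := ((n⁻¹ : ℝ) : ℂ) • (1 : Mat ι) with hσdef
  have hσA : σ ∈ A.car := A.smul_mem _ A.one_mem
  have hσp : σ.PosSemidef := Matrix.PosSemidef.one.smul (by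
    rw [Complex.zero_le_real]; positivity)
  have hσt : σ.trace = 1 := by
    rw [hσdef, Matrix.trace_smul, Matrix.trace_one, hndef]
    have : (Fintype.card ι : ℂ) ≠ 0 := by exact_mod_cast Fintype.card_ne_zero
    simp [this]
  have key : ∀ t : ℝ, |t| = 1 → ((n * (c + 1)) • PhiI δ σ + t • Γ) ∈ PstarL Pf D A := by
    intro t ht
    refine ⟨aux_herm_add (aux_herm_smul (aux_phi_herm hσp.1) _) (aux_herm_smul hΓ.1 _),
      ⟨fun a => ?_, fun a => ?_⟩, fun χ hχ => ?_⟩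
    · have h1 := A.smul_mem ((n * (c + 1) : ℝ) : ℂ) (A.smul_mem a.trace hσA)
      have h2 := A.smul_mem (t : ℂ) (hΓ.2.1.1 a)
      exact A.add_mem h1 h2
    · have : (D.E a).trace = a.trace := by simpa using D.E_trace a 1 D.one_mem
      simp [PhiI, this, hΓ.2.1.2 a]
    · have hχp := Pf.le_pos _ _ hχ
      have hl := hχp.1.1
      rw [aux_pairing_add hl, aux_pairing_smul hl, aux_pairing_smul hl, aux_pairing_phi hl, hσdef,
        hl.map_smul, Matrix.trace_smul, smul_eq_mul, Complex.re_ofReal_mul]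
      have h1 := hc χ hχp
      have h0 : 0 ≤ (χ 1).trace.re :=
        (Complex.nonneg_iff.mp (hχp.2 1 Matrix.PosSemidef.one).trace_nonneg).1
      have h2 : |t * pairing Γ χ| = |pairing Γ χ| := by rw [abs_mul, ht, one_mul]
      have h3 := neg_abs_le (t * pairing Γ χ)
      have h4 : n * (c + 1) * (n⁻¹ * (χ 1).trace.re) = (c + 1) * (χ 1).trace.re := by
        field_simp
      rw [h4]
      linarith
  refine ⟨n * (c + 1), by positivity, σ, ⟨hσA, hσp, hσt⟩, ?_, ?_⟩
  · have := key (-1) (by simp)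
    simpa [sub_eq_add_neg] using this
  · have := key 1 (by simp)
    simpa using this

lemma aux_norm_le (Pf : AdmissibleFamily) (hcp : CPSet ι κ ⊆ Pf.P ι κ) {A : FdSubalgebra ι}
    {B : FdSubalgebra κ} {D : FdSubalgebra δ} {α : HMap κ δ} (hα : α ∈ ChanP Pf B D)
    {Γ : HMap δ ι} (hΓ : Γ ∈ PstarL Pf D A) :
    udnormCP B A (Γ ∘ α) ≤ udnormP Pf D A Γ := by
  unfold udnormCP udnormP
  rcases isEmpty_or_nonempty ι with he | hne
  · have : ∀ σ, σ ∉ States A := by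
      intro σ hσ
      have := hσ.2.2
      simp [Matrix.trace] at this
    simp [this]
  · refine csInf_le_csInf ⟨0, fun l hl => hl.1.le⟩ (aux_norm_nonempty Pf hΓ) ?_
    rintro l ⟨hl, σ, hσ, h1, h2⟩
    have e : PhiI δ σ ∘ α = PhiI κ σ := by
      funext a; simp [PhiI, hα.2 a]
    have h1 := aux_star_cp Pf hcp (aux_star_comp Pf hα h1)
    have h2 := aux_star_cp Pf hcp (aux_star_comp Pf hα h2)
    refine ⟨hl, σ, hσ, ?_, ?_⟩
    · rw [← e]; exact h1
    · rw [← e]; exact h2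

end Helpers

/-- For channels that are both `𝒫`-positive and completely positive, CP-deficiency implies
`𝒫`-deficiency (for `ε = 0` in general, and for all `ε ≥ 0` when `CP ⊆ 𝒫`). -/
theorem statement9 (Pf : AdmissibleFamily) {ι κ κ' : Type}
    [Fintype ι] [DecidableEq ι] [Fintype κ] [DecidableEq κ] [Fintype κ'] [DecidableEq κ']
    (A : FdSubalgebra ι) (B : FdSubalgebra κ) (B' : FdSubalgebra κ')
    (Φ : HMap ι κ) (hΦ : Φ ∈ ChanP Pf A B) (hΦcp : Φ ∈ CPSet ι κ)
    (Ψ : HMap ι κ') (hΨ : Ψ ∈ ChanP Pf A B') (hΨcp : Ψ ∈ CPSet ι κ') :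
    ((∀ (δ : Type) [Fintype δ] [DecidableEq δ] (D : FdSubalgebra δ),
        PostDeficientCP A B B' D Φ Ψ 0) →
      ∀ (δ : Type) [Fintype δ] [DecidableEq δ] (D : FdSubalgebra δ),
        PostDeficientP Pf A B B' D Φ Ψ 0)
    ∧ ((∀ (ι₀ κ₀ : Type) [Fintype ι₀] [DecidableEq ι₀] [Fintype κ₀] [DecidableEq κ₀],
          CPSet ι₀ κ₀ ⊆ Pf.P ι₀ κ₀) →
        ∀ ε : ℝ, 0 ≤ ε →
          (∀ (δ : Type) [Fintype δ] [DecidableEq δ] (D : FdSubalgebra δ),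
            PostDeficientCP A B B' D Φ Ψ ε) →
          ∀ (δ : Type) [Fintype δ] [DecidableEq δ] (D : FdSubalgebra δ),
            PostDeficientP Pf A B B' D Φ Ψ ε) := by
  have hEΦ : B.E ∘ Φ = Φ := funext fun a => B.E_fix _ (hΦ.1.2.1 a)
  refine ⟨?_, ?_⟩
  · intro H δ _ _ D Γ hΓ α hα
    have hG := aux_star_comp Pf hα hΓ
    obtain ⟨c, hc⟩ := aux_cp_shift hG.1
    have hmem : c • PhiI κ (1 : Mat ι) + Γ ∘ α ∈ CPL B A := by
      refine ⟨hc, fun a => ?_, fun a => ?_⟩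
      · exact A.add_mem (A.smul_mem (c : ℂ) (A.smul_mem a.trace A.one_mem)) (hG.2.1.1 a)
      · have h1 : (B.E a).trace = a.trace := by simpa using B.E_trace a 1 B.one_mem
        have h2 := hG.2.1.2 a
        simp only [Pi.add_apply, Pi.smul_apply, PhiI, h1, h2]
    obtain ⟨β, hβ, h⟩ := H κ B _ hmem B.E (aux_E_chan B)
    refine ⟨α ∘ β, aux_chan_comp Pf hα hβ, ?_⟩
    have hβΨ : TP (β ∘ Ψ) := fun a => by
      simp only [Function.comp]; rw [hβ.2, hΨ.2]
    rw [hEΦ, aux_pairing_shift _ hΦ.2, aux_pairing_shift _ hβΨ, zero_mul] at h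
    rw [zero_mul]
    change pairing Φ (Γ ∘ α) ≤ pairing (β ∘ Ψ) (Γ ∘ α) + 0
    linarith
  · intro hcp ε hε H δ _ _ D Γ hΓ α hα
    have hG := aux_star_cp Pf (hcp ι κ) (aux_star_comp Pf hα hΓ)
    obtain ⟨β, hβ, h⟩ := H κ B _ hG B.E (aux_E_chan B)
    refine ⟨α ∘ β, aux_chan_comp Pf hα hβ, ?_⟩
    rw [hEΦ] at h
    have hn := mul_le_mul_of_nonneg_left (aux_norm_le Pf (hcp ι κ) hα hΓ) hε
    change pairing Φ (Γ ∘ α) ≤ pairing (β ∘ Ψ) (Γ ∘ α) + _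
    linarith
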